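/- Let G = (V,E) be a finite simple undirected connected graph. Then |S| ≤ |N(S)| holds for every independent set S ⊆ V (equivalently ν̄_G ≤ 0) if and only if G admits a perfect 2-matching, i.e., an assignment of weights 0, 1 or 2 to the edges of G such that for every vertex the sum of the weights of the incident edges equals exactly 2. -/

import Mathlib

open Finset

variable {V : Type*}

/-- `N(T)`: the set of vertices adjacent to at least one vertex of `T`. -/
def nbhd [Fintype V] [DecidableEq V] (G : SimpleGraph V) [DecidableRel G.Adj]
    (T : Finset V) : Finset V :=
  Finset.univ.filter fun j => ∃ i ∈ T, G.Adj i j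

/-- `S` is an independent set of `G`. -/
def IsIndepF (G : SimpleGraph V) (S : Finset V) : Prop :=
  ∀ i ∈ S, ∀ j ∈ S, ¬ G.Adj i j

/-- `H` admits a perfect 2-matching: an assignment of weights `0`, `1` or `2` to the edges of
`H` such that for every vertex the sum of the weights of the incident edges equals exactly 2. -/
def HasPerfect2Matching {W : Type*} (H : SimpleGraph W) : Prop :=
  ∃ w : Sym2 W → ℕ, (∀ e ∈ H.edgeSet, w e ≤ 2) ∧
    ∀ v : W, ∑ᶠ e ∈ H.incidenceSet v, w e = 2

/-- The weight at a vertex is the sum of the weights of the edges to its neighbours. -/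
theorem finsum_incidenceSet_eq_sum_neighborFinset [Fintype V] [DecidableEq V]
    (G : SimpleGraph V) [DecidableRel G.Adj] (w : Sym2 V → ℕ) (v : V) :
    ∑ᶠ e ∈ G.incidenceSet v, w e = ∑ j ∈ G.neighborFinset v, w s(v, j) := by
  have himage : G.incidenceSet v = (fun j => s(v, j)) '' (G.neighborFinset v : Set V) := by
    ext e
    induction e with
    | _ a b =>
      simp only [SimpleGraph.mk'_mem_incidenceSet_iff, Set.mem_image, SimpleGraph.coe_neighborFinset,
        SimpleGraph.mem_neighborSet]
      constructor
      · rintro ⟨hab, rfl | rfl⟩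
        · exact ⟨b, hab, rfl⟩
        · exact ⟨a, hab.symm, Sym2.eq_swap⟩
      · rintro ⟨j, hj, h⟩
        rcases Sym2.eq_iff.1 h with ⟨rfl, rfl⟩ | ⟨rfl, rfl⟩
        · exact ⟨hj, Or.inl rfl⟩
        · exact ⟨hj.symm, Or.inr rfl⟩
  rw [himage, finsum_mem_image, finsum_mem_coe_finset]
  intro a _ b _ h
  exact Sym2.congr_right.1 h

/-- If no independent set has fewer neighbours than elements, then no set of vertices does. -/
theorem card_le_card_nbhd_of_forall_isIndepF [Fintype V] [DecidableEq V]
    (G : SimpleGraph V) [DecidableRel G.Adj]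
    (h : ∀ S : Finset V, IsIndepF G S → S.card ≤ (nbhd G S).card) (T : Finset V) :
    T.card ≤ (nbhd G T).card := by
  have hindep : IsIndepF G (T \ nbhd G T) := by
    intro i hi j hj hij
    simp only [nbhd, mem_sdiff, mem_filter, mem_univ, true_and] at hi hj
    exact hj.2 ⟨i, hi.1, hij⟩
  have hdisj : Disjoint (nbhd G (T \ nbhd G T)) (T ∩ nbhd G T) := by
    rw [Finset.disjoint_left]
    intro j hj hjT
    simp only [nbhd, mem_sdiff, mem_inter, mem_filter, mem_univ, true_and] at hj hjT
    obtain ⟨i, hi, hij⟩ := hj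
    exact hi.2 ⟨j, hjT.1, hij.symm⟩
  have hsub : nbhd G (T \ nbhd G T) ∪ (T ∩ nbhd G T) ⊆ nbhd G T := by
    refine union_subset ?_ inter_subset_right
    intro j hj
    simp only [nbhd, mem_sdiff, mem_filter, mem_univ, true_and] at hj ⊢
    obtain ⟨i, hi, hij⟩ := hj
    exact ⟨i, hi.1, hij⟩
  calc T.card = (T \ nbhd G T).card + (T ∩ nbhd G T).card := (card_sdiff_add_card_inter _ _).symm
    _ ≤ (nbhd G (T \ nbhd G T)).card + (T ∩ nbhd G T).card := Nat.add_le_add_right (h _ hindep) _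
    _ = (nbhd G (T \ nbhd G T) ∪ (T ∩ nbhd G T)).card := (card_union_of_disjoint hdisj).symm
    _ ≤ (nbhd G T).card := card_le_card hsub

/-- A permutation moving every vertex to a neighbour yields a perfect 2-matching. -/
theorem hasPerfect2Matching_of_perm [Finite V] (G : SimpleGraph V)
    (f : Equiv.Perm V) (hf : ∀ v, G.Adj v (f v)) : HasPerfect2Matching G := by
  classical
  have := Fintype.ofFinite V
  refine ⟨Sym2.lift ⟨fun i j => (if f i = j then 1 else 0) + (if f j = i then 1 else 0),
    fun i j => add_comm _ _⟩, ?_, ?_⟩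
  · intro e _
    induction e with
    | _ a b =>
      simp only [Sym2.lift_mk]
      split_ifs <;> omega
  · intro v
    rw [finsum_incidenceSet_eq_sum_neighborFinset]
    simp only [Sym2.lift_mk, sum_add_distrib]
    have hsymm : ∀ j, f j = v ↔ f.symm v = j := fun j => by
      rw [Equiv.symm_apply_eq, eq_comm]
    have hadj : G.Adj v (f.symm v) := by simpa using (hf (f.symm v)).symm
    simp [hsymm, hf v, hadj]

/-- In a graph with a perfect 2-matching, every set of vertices has at least as many neighbours
as elements. -/
theorem HasPerfect2Matching.card_le_card_nbhd [Fintype V] [DecidableEq V]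
    {G : SimpleGraph V} [DecidableRel G.Adj] (h : HasPerfect2Matching G) (S : Finset V) :
    S.card ≤ (nbhd G S).card := by
  obtain ⟨w, -, hw⟩ := h
  simp only [finsum_incidenceSet_eq_sum_neighborFinset] at hw
  have hle : ∑ i ∈ S, ∑ j ∈ G.neighborFinset i, w s(i, j) ≤
      ∑ j ∈ nbhd G S, ∑ i ∈ G.neighborFinset j, w s(j, i) := by
    calc ∑ i ∈ S, ∑ j ∈ G.neighborFinset i, w s(i, j)
        = ∑ j ∈ nbhd G S, ∑ i ∈ S with G.Adj j i, w s(i, j) := by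
          refine sum_comm' fun i j => ?_
          simp only [nbhd, SimpleGraph.mem_neighborFinset, mem_filter, mem_univ, true_and]
          exact ⟨fun hij => ⟨⟨hij.1, hij.2.symm⟩, i, hij⟩, fun hij => ⟨hij.1.1, hij.1.2.symm⟩⟩
      _ ≤ ∑ j ∈ nbhd G S, ∑ i ∈ G.neighborFinset j, w s(j, i) := by
          refine sum_le_sum fun j _ => ?_
          simp only [Sym2.eq_swap (b := j)]
          refine sum_le_sum_of_subset fun i hi => ?_
          simpa using (mem_filter.1 hi).2
  simp only [hw, sum_const, smul_eq_mul] at hle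
  omega

/-- For a finite simple undirected connected graph `G`, `|S| ≤ |N(S)|` holds for every
independent set `S ⊆ V` (equivalently `ν̄_G ≤ 0`) if and only if `G` admits a perfect
2-matching. -/
theorem nonpos_vulnerability_iff_hasPerfect2Matching
    [Fintype V] [DecidableEq V] (G : SimpleGraph V) [DecidableRel G.Adj]
    (hconn : G.Connected) :
    (∀ S : Finset V, IsIndepF G S → S.card ≤ (nbhd G S).card) ↔ HasPerfect2Matching G := by
  refine ⟨fun h => ?_, fun h S _ => h.card_le_card_nbhd S⟩
  obtain ⟨f, hinj, hf⟩ :=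
    (Fintype.all_card_le_filter_rel_iff_exists_injective G.Adj).1 fun T =>
      card_le_card_nbhd_of_forall_isIndepF G h T
  exact hasPerfect2Matching_of_perm G
    (Equiv.ofBijective f (Finite.injective_iff_bijective.1 hinj)) hf
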